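/- Let A₁, A₂ ∈ SL(2,ℂ) with tr A₁, tr A₂ and tr(A₁A₂) all real, and suppose the pair (A₁,A₂) is elementwise-periodic. Then at least one of the following holds: (1) the subgroup of SL(2,ℂ) generated by A₁ and A₂ is finite; (2) the associated point χ(id) lies on a coordinate axis of ℝ³, i.e. at least two of its three coordinates are zero; (3) there exists P ∈ GL(2,ℂ) such that P A₁ P⁻¹ and P A₂ P⁻¹ are both lower triangular matrices whose diagonal entries are roots of unity. -/

import Mathlib

open Matrix

noncomputable section

abbrev SL2C := Matrix.SpecialLinearGroup (Fin 2) ℂ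

/-- The representation `F₂ → SL(2,ℂ)` sending `a₁ ↦ A₁`, `a₂ ↦ A₂`. -/
def rho (A₁ A₂ : SL2C) : FreeGroup (Fin 2) →* SL2C := FreeGroup.lift ![A₁, A₂]

/-- `χ(α) = (tr ρ(α a₁)/2, tr ρ(α a₂)/2, tr ρ(α (a₁a₂))/2)`. -/
def chi (A₁ A₂ : SL2C) (α : MulAut (FreeGroup (Fin 2))) : ℂ × ℂ × ℂ :=
  ( Matrix.trace ((rho A₁ A₂ (α (FreeGroup.of 0)) : Matrix (Fin 2) (Fin 2) ℂ)) / 2,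
    Matrix.trace ((rho A₁ A₂ (α (FreeGroup.of 1)) : Matrix (Fin 2) (Fin 2) ℂ)) / 2,
    Matrix.trace ((rho A₁ A₂ (α (FreeGroup.of 0 * FreeGroup.of 1)) : Matrix (Fin 2) (Fin 2) ℂ)) / 2 )

/-- `(A₁,A₂)` is elementwise-periodic: for every automorphism `α` of `F₂`,
the set `{χ(αᵏ) : k ∈ ℕ}` is finite. -/
def ElemPeriodic (A₁ A₂ : SL2C) : Prop :=
  ∀ α : MulAut (FreeGroup (Fin 2)), (Set.range fun k : ℕ => chi A₁ A₂ (α ^ k)).Finite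

/-! ### Trace dynamics -/

section Dyn
variable {R S : Type*} [CommRing R] [CommRing S]

def tT (p : R × R × R) : R × R × R := (p.1, p.2.2, p.1 * p.2.2 - p.2.1)
def tC (p : R × R × R) : R × R × R := (p.2.1, p.2.2, p.1)

def act : List Bool → R × R × R → R × R × R
  | [], p => p
  | true :: w, p => tT (act w p)
  | false :: w, p => tC (act w p)

def mp (f : R →+* S) (p : R × R × R) : S × S × S := (f p.1, f p.2.1, f p.2.2)

def PerT (p : R × R × R) : Prop :=
  ∀ w, ∃ N : ℕ, 0 < N ∧ tT^[N] (act w p) = act w p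

def OffAxis (p : R × R × R) : Prop :=
  ¬ (p.1 = 0 ∧ p.2.1 = 0) ∧ ¬ (p.1 = 0 ∧ p.2.2 = 0) ∧ ¬ (p.2.1 = 0 ∧ p.2.2 = 0)

def DD (p : R × R × R) : R :=
  4 - p.1 ^ 2 - p.2.1 ^ 2 - p.2.2 ^ 2 + p.1 * p.2.1 * p.2.2

lemma tT_inj : Function.Injective (tT : R × R × R → R × R × R) := by
  rintro ⟨a, b, c⟩ ⟨a', b', c'⟩ h
  simp only [tT, Prod.mk.injEq] at h
  obtain ⟨rfl, rfl, h⟩ := h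
  simp only [Prod.mk.injEq, true_and, and_true]
  linear_combination -h

lemma mp_tT (f : R →+* S) (p : R × R × R) : mp f (tT p) = tT (mp f p) := by
  simp [mp, tT]

lemma mp_tC (f : R →+* S) (p : R × R × R) : mp f (tC p) = tC (mp f p) := by
  simp [mp, tC]

lemma mp_act (f : R →+* S) (w : List Bool) (p : R × R × R) :
    mp f (act w p) = act w (mp f p) := by
  induction w with
  | nil => rfl
  | cons m w ih => cases m <;> simp [act, mp_tT, mp_tC, ih]

lemma mp_iter (f : R →+* S) (n : ℕ) (p : R × R × R) :
    mp f (tT^[n] p) = tT^[n] (mp f p) := by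
  induction n with
  | zero => rfl
  | succ n ih => simp only [Function.iterate_succ_apply', mp_tT, ih]

lemma mp_inj (f : R →+* S) (hf : Function.Injective f) : Function.Injective (mp f) := by
  rintro ⟨a, b, c⟩ ⟨a', b', c'⟩ h
  simp only [mp, Prod.mk.injEq] at h
  rw [hf h.1, hf h.2.1, hf h.2.2]

lemma PerT.map (f : R →+* S) {p : R × R × R} (h : PerT p) : PerT (mp f p) := by
  intro w
  obtain ⟨N, hN, e⟩ := h w
  exact ⟨N, hN, by rw [← mp_act, ← mp_iter, e]⟩

lemma PerT.of_map (f : R →+* S) (hf : Function.Injective f) {p : R × R × R}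
    (h : PerT (mp f p)) : PerT p := by
  intro w
  obtain ⟨N, hN, e⟩ := h w
  exact ⟨N, hN, mp_inj f hf (by rw [mp_iter, mp_act, e])⟩

lemma OffAxis.map (f : R →+* S) (hf : Function.Injective f) {p : R × R × R}
    (h : OffAxis p) : OffAxis (mp f p) := by
  simpa only [OffAxis, mp, map_eq_zero_iff f hf] using h

lemma OffAxis.of_map (f : R →+* S) (hf : Function.Injective f) {p : R × R × R}
    (h : OffAxis (mp f p)) : OffAxis p := by
  simpa only [OffAxis, mp, map_eq_zero_iff f hf] using h

lemma DD_map (f : R →+* S) (p : R × R × R) : DD (mp f p) = f (DD p) := by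
  have h4 : f 4 = 4 := map_ofNat f 4
  simp [DD, mp, h4]

lemma act_append (v w : List Bool) (p : R × R × R) : act (v ++ w) p = act v (act w p) := by
  induction v with
  | nil => rfl
  | cons m v ih => cases m <;> simp [act, ih]

lemma PerT.act {p : R × R × R} (h : PerT p) (w : List Bool) : PerT (act w p) := by
  intro v
  simpa [act_append] using h (v ++ w)

lemma OffAxis.tC {p : R × R × R} (h : OffAxis p) : OffAxis (tC p) := by
  simp only [OffAxis, _root_.tC] at *
  tauto

lemma OffAxis.tT {p : R × R × R} (h : OffAxis p) : OffAxis (tT p) := by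
  obtain ⟨a, b, c⟩ := p
  obtain ⟨h1, h2, h3⟩ := h
  simp only [OffAxis, _root_.tT] at *
  refine ⟨h2, ?_, ?_⟩
  · rintro ⟨rfl, h⟩
    exact h1 ⟨rfl, by linear_combination -h⟩
  · rintro ⟨rfl, h⟩
    exact h3 ⟨by linear_combination -h, rfl⟩

lemma OffAxis.act {p : R × R × R} (h : OffAxis p) (w : List Bool) :
    OffAxis (act w p) := by
  induction w with
  | nil => exact h
  | cons m w ih =>
    cases m
    · exact ih.tC
    · exact ih.tT

lemma DD_act (w : List Bool) (p : R × R × R) : DD (act w p) = DD p := by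
  induction w with
  | nil => rfl
  | cons m w ih =>
    rw [← ih]
    cases m
    · simp only [DD, act, tC]; ring
    · simp only [DD, act, tT]; ring

lemma act_replicate (n : ℕ) (p : R × R × R) : act (List.replicate n true) p = tT^[n] p := by
  induction n with
  | zero => rfl
  | succ n ih => simp only [List.replicate_succ, act, ih, Function.iterate_succ_apply']

lemma iter_fst (n : ℕ) (p : R × R × R) : (tT^[n] p).1 = p.1 := by
  induction n with
  | zero => rfl
  | succ n ih => simp only [Function.iterate_succ_apply', tT, ih]

end Dyn

/-- Eigenvalues are roots of unity. -/
lemma root_lem {K : Type*} [Field K] (p : K × K × K) (hp : OffAxis p) (N : ℕ)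
    (h : tT^[N] p = p) (l : K) (hl : l ^ 2 - p.1 * l + 1 = 0) : l ^ (2 * N) = 1 := by
  have hl0 : l ≠ 0 := by rintro rfl; simp at hl
  have h1 : ∀ n, ((tT^[n] p).2.2 - l * (tT^[n] p).2.1) * l ^ n = p.2.2 - l * p.2.1 := by
    intro n
    induction n with
    | zero => simp
    | succ n ih =>
      have := iter_fst n p
      rw [Function.iterate_succ_apply', ← ih]
      simp only [tT, this]
      linear_combination (-(tT^[n] p).2.2 * l ^ n) * hl
  have h2 : ∀ n, (l * (tT^[n] p).2.2 - (tT^[n] p).2.1) = l ^ n * (l * p.2.2 - p.2.1) := by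
    intro n
    induction n with
    | zero => simp
    | succ n ih =>
      have := iter_fst n p
      rw [Function.iterate_succ_apply', pow_succ', mul_assoc, ← ih]
      simp only [tT, this]
      linear_combination (-(tT^[n] p).2.2) * hl
  have e1 := h1 N
  have e2 := h2 N
  rw [h] at e1 e2
  by_cases hN : l ^ N = 1
  · rw [mul_comm, pow_mul, hN, one_pow]
  have z1 : p.2.2 - l * p.2.1 = 0 := by
    have : (p.2.2 - l * p.2.1) * (l ^ N - 1) = 0 := by linear_combination e1
    rcases mul_eq_zero.1 this with h | h
    · exact h
    · exact absurd (sub_eq_zero.1 h) hN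
  have z2 : l * p.2.2 - p.2.1 = 0 := by
    have : (l * p.2.2 - p.2.1) * (l ^ N - 1) = 0 := by linear_combination -e2
    rcases mul_eq_zero.1 this with h | h
    · exact h
    · exact absurd (sub_eq_zero.1 h) hN
  have z3 : (l ^ 2 - 1) * p.2.1 = 0 := by linear_combination z2 - l * z1
  rcases mul_eq_zero.1 z3 with h | h
  · rw [pow_mul, sub_eq_zero.1 h, one_pow]
  · exfalso
    apply hp.2.2
    rw [h] at z1
    exact ⟨h, by simpa using z1⟩

lemma exists_eig (x : ℂ) : ∃ l : ℂ, l ^ 2 - x * l + 1 = 0 := by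
  obtain ⟨s, hs⟩ := IsAlgClosed.exists_pow_nat_eq (x ^ 2 - 4) (n := 2) (by norm_num)
  exact ⟨(x + s) / 2, by linear_combination hs / 4⟩

lemma fst_props (p : ℂ × ℂ × ℂ) (hp : OffAxis p) (h : PerT p) :
    IsIntegral ℤ p.1 ∧ ∃ r : ℝ, p.1 = r ∧ |r| ≤ 2 := by
  obtain ⟨N, hN, e⟩ := h []
  obtain ⟨l, hl⟩ := exists_eig p.1
  have hr := root_lem p hp N e l hl
  have hl0 : l ≠ 0 := by rintro rfl; simp at hl
  have hx : p.1 = l + l⁻¹ := by field_simp; linear_combination -hl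
  have hN2 : 0 < 2 * N := by omega
  have hn : ‖l‖ = 1 := by
    exact Complex.norm_eq_one_of_pow_eq_one hr hN2.ne'
  constructor
  · rw [hx]
    refine IsIntegral.add ?_ ?_
    · exact IsIntegral.of_pow hN2 (by rw [hr]; exact isIntegral_one)
    · exact IsIntegral.of_pow hN2 (by rw [inv_pow, hr, inv_one]; exact isIntegral_one)
  · refine ⟨2 * l.re, ?_, ?_⟩
    · rw [hx, Complex.inv_eq_conj hn, Complex.add_conj]
      
    · have := Complex.abs_re_le_norm l
      rw [abs_mul, abs_two]; linarith

lemma coord_props (p : ℂ × ℂ × ℂ) (hp : OffAxis p) (h : PerT p) :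
    (IsIntegral ℤ p.1 ∧ IsIntegral ℤ p.2.1 ∧ IsIntegral ℤ p.2.2) ∧
    ∃ r : ℝ × ℝ × ℝ, p = mp Complex.ofRealHom r ∧ |r.1| ≤ 2 := by
  obtain ⟨i1, r1, e1, b1⟩ := fst_props p hp h
  obtain ⟨i2, r2, e2, b2⟩ := fst_props _ (hp.act [false]) (h.act [false])
  obtain ⟨i3, r3, e3, b3⟩ := fst_props _ (hp.act [false, false]) (h.act [false, false])
  simp only [act, tC] at i2 e2 i3 e3
  refine ⟨⟨i1, i2, i3⟩, (r1, r2, r3), ?_, b1⟩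
  simp [mp, ← e1, ← e2, ← e3]

/-- growth step inequality -/
lemma growth_ineq (a u v d : ℝ) (ha : |a| ≤ 2) (hd : 0 < d) (hv : |v| ≤ |u|)
    (huv : a ^ 2 * u ^ 2 / 2 ≤ a * (u * v)) (hQ : u ^ 2 + v ^ 2 - a * (u * v) = 4 - a ^ 2 + d) :
    a ^ 2 + d / 2 ≤ u ^ 2 := by
  -- reduce to `0 ≤ a`
  wlog h0 : 0 ≤ a generalizing a v with H
  · refine le_of_eq_of_le ?_ (H (-a) (-v) (by simpa using ha) (by simpa using hv) (by nlinarith)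
      (by nlinarith) (by linarith))
    ring
  rw [abs_of_nonneg h0] at ha
  have hu2 : v ^ 2 ≤ u ^ 2 := sq_le_sq.2 hv
  have huv' : u * v ≤ u ^ 2 := by nlinarith [sq_nonneg (u - v)]
  have key : 4 - a ^ 2 + d ≤ u ^ 2 * (2 - a) := by
    rcases h0.eq_or_lt with rfl | hpos
    · nlinarith
    have h1 : a * u ^ 2 / 2 ≤ u * v := by
      have : a * (a * u ^ 2 / 2) ≤ a * (u * v) := by nlinarith
      exact le_of_mul_le_mul_left this hpos
    by_cases hu : u = 0
    · subst hu
      have : v = 0 := by simpa using hv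
      subst this
      nlinarith
    have hupos : 0 < u ^ 2 := by positivity
    have h2 : 0 ≤ (u ^ 2 - u * v) * (u ^ 2 + u * v - a * u ^ 2) := by
      apply mul_nonneg
      · linarith
      · nlinarith
    have h3 : 0 ≤ u ^ 2 * (u ^ 2 * (2 - a) - (u ^ 2 + v ^ 2 - a * (u * v))) := by
      nlinarith
    have := nonneg_of_mul_nonneg_right h3 hupos
    linarith
  have h2a : 0 < 2 - a := by
    rcases ha.eq_or_lt with rfl | h
    · nlinarith
    · linarith
  by_contra hc
  push Not at hc
  have : u ^ 2 * (2 - a) < (a ^ 2 + d / 2) * (2 - a) := mul_lt_mul_of_pos_right hc h2a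
  nlinarith [mul_nonneg h0 hd.le, mul_nonneg h2a.le (mul_nonneg h2a.le (by linarith : 0 ≤ 1 + a))]

lemma growth_step (p : ℝ × ℝ × ℝ) (h : PerT p) (ha : |p.1| ≤ 2) (hD : DD p < 0) :
    ∃ w, p.1 ^ 2 + (-DD p) / 2 ≤ (act w p).1 ^ 2 := by
  obtain ⟨N, hN, e⟩ := h []
  change tT^[N] p = p at e
  set u : ℕ → ℝ := fun n => (tT^[n] p).2.1 with hu
  have hper : ∀ n, tT^[n + N] p = tT^[n] p := by
    intro n; rw [Function.iterate_add_apply, e]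
  have hu1 : ∀ n, (tT^[n] p).2.2 = u (n + 1) := by
    intro n; simp only [hu, Function.iterate_succ_apply', tT]
  have hrec : ∀ n, u (n + 2) = p.1 * u (n + 1) - u n := by
    intro n
    rw [← hu1 (n + 1), ← hu1 n, Function.iterate_succ_apply']
    simp only [tT, iter_fst, hu]
  obtain ⟨m, hm, hmax⟩ := Finset.exists_max_image (Finset.range N) (fun n => |u n|)
    ⟨0, by simpa using hN⟩
  have hmod : ∀ n, u n = u (n % N) := by
    intro n
    have : ∀ k j, u (j + N * k) = u j := by
      intro k
      induction k with
      | zero => simp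
      | succ k ih =>
        intro j
        rw [← ih j]
        simp only [hu]
        rw [← hper (j + N * k), mul_add, mul_one, add_assoc]
    conv_lhs => rw [← Nat.mod_add_div n N]
    exact this _ _
  have hmax' : ∀ n, |u n| ≤ |u m| := by
    intro n
    rw [hmod n]
    exact hmax _ (Finset.mem_range.2 (Nat.mod_lt _ hN))
  -- shifted index so that the predecessor exists
  obtain ⟨j, hj⟩ : ∃ j, j + 1 = m + N := ⟨m + N - 1, by omega⟩
  have hum : u (j + 1) = u m := by rw [hj]; simp only [hu, hper]
  have inv : ∀ n, u n ^ 2 + u (n + 1) ^ 2 - p.1 * (u n * u (n + 1)) = 4 - p.1 ^ 2 + -DD p := by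
    intro n
    rw [← DD_act (List.replicate n true) p, act_replicate, ← hu1 n]
    simp only [DD, iter_fst, hu]
    ring
  refine ⟨false :: List.replicate (j + 1) true, ?_⟩
  rw [act, act_replicate]
  change _ ≤ (u (j + 1)) ^ 2
  have i1 := inv j
  have i2 := inv (j + 1)
  have r := hrec j
  have m1 := hmax' j
  have m2 := hmax' (j + 2)
  rw [← hum] at m1 m2
  by_cases hc : p.1 ^ 2 * u (j + 1) ^ 2 / 2 ≤ p.1 * (u (j + 1) * u j)
  · exact growth_ineq p.1 (u (j + 1)) (u j) _ ha (by linarith) m1 hc (by linarith)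
  · push Not at hc
    refine growth_ineq p.1 (u (j + 1)) (u (j + 2)) _ ha (by linarith) m2 ?_ (by linarith)
    rw [r]
    nlinarith

lemma DD_nonneg (p : ℝ × ℝ × ℝ) (h : PerT p) (ha : ∀ w, |(act w p).1| ≤ 2) : 0 ≤ DD p := by
  by_contra hD
  push Not at hD
  have key : ∀ k : ℕ, ∃ w, k * ((-DD p) / 2) ≤ (act w p).1 ^ 2 := by
    intro k
    induction k with
    | zero => exact ⟨[], by simp [sq_nonneg]⟩
    | succ k ih =>
      obtain ⟨w, hw⟩ := ih
      obtain ⟨v, hv⟩ := growth_step (act w p) (h.act w) (ha w) (by rwa [DD_act])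
      refine ⟨v ++ w, ?_⟩
      rw [act_append]
      rw [DD_act] at hv
      push_cast
      linarith
  obtain ⟨k, hk⟩ := exists_nat_gt (4 / ((-DD p) / 2))
  obtain ⟨w, hw⟩ := key k
  rw [div_lt_iff₀ (by linarith)] at hk
  have := sq_le_sq.2 ((ha w).trans (le_abs_self 2))
  linarith

/-- Main consequence for a complex triple. -/
lemma complex_main (p : ℂ × ℂ × ℂ) (hp : OffAxis p) (h : PerT p) :
    ∃ r : ℝ × ℝ × ℝ, p = mp Complex.ofRealHom r ∧ 0 ≤ DD r ∧ |r.1| ≤ 2 := by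
  obtain ⟨-, r, hr, hb⟩ := coord_props p hp h
  refine ⟨r, hr, ?_, hb⟩
  have inj : Function.Injective Complex.ofRealHom := Complex.ofReal_injective
  subst hr
  apply DD_nonneg r (h.of_map _ inj)
  intro w
  obtain ⟨-, s, hs, hb⟩ := fst_props _ (hp.act w) (h.act w)
  rw [← mp_act] at hs
  have : (act w r).1 = s := by
    simpa [mp] using hs
  rwa [this]

/-! ### Automorphisms -/

def tr3 (g h : SL2C) : ℂ × ℂ × ℂ :=
  (Matrix.trace (g : Matrix (Fin 2) (Fin 2) ℂ), Matrix.trace (h : Matrix (Fin 2) (Fin 2) ℂ),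
    Matrix.trace ((g * h : SL2C) : Matrix (Fin 2) (Fin 2) ℂ))

def XX (A₁ A₂ : SL2C) (α : MulAut (FreeGroup (Fin 2))) : ℂ × ℂ × ℂ :=
  tr3 (rho A₁ A₂ (α (FreeGroup.of 0))) (rho A₁ A₂ (α (FreeGroup.of 1)))

lemma det_eq (g : SL2C) : g.1 0 0 * g.1 1 1 - g.1 0 1 * g.1 1 0 = 1 := by
  have := g.2
  rwa [Matrix.det_fin_two] at this

lemma tr3_T (g h : SL2C) : tr3 g (g * h) = tT (tr3 g h) := by
  have hg := det_eq g
  simp only [tr3, tT, Prod.mk.injEq, true_and, Matrix.SpecialLinearGroup.coe_mul,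
    Matrix.trace_fin_two, Matrix.mul_apply, Fin.sum_univ_two]
  linear_combination -(h.1 0 0 + h.1 1 1) * hg

lemma tr_inv (g : SL2C) : Matrix.trace ((g⁻¹ : SL2C) : Matrix (Fin 2) (Fin 2) ℂ)
    = Matrix.trace (g : Matrix (Fin 2) (Fin 2) ℂ) := by
  rw [Matrix.SpecialLinearGroup.coe_inv, Matrix.adjugate_fin_two, Matrix.trace_fin_two,
    Matrix.trace_fin_two]
  simp [add_comm]

lemma tr3_C (g h : SL2C) : tr3 h (g * h)⁻¹ = tC (tr3 g h) := by
  have e : h * (g * h)⁻¹ = g⁻¹ := by group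
  simp only [tr3, tC, e, tr_inv]

def gena : FreeGroup (Fin 2) := FreeGroup.of 0
def genb : FreeGroup (Fin 2) := FreeGroup.of 1

def autT : MulAut (FreeGroup (Fin 2)) :=
  MonoidHom.toMulEquiv (FreeGroup.lift ![gena, gena * genb]) (FreeGroup.lift ![gena, gena⁻¹ * genb])
    (by ext i; fin_cases i <;> simp [gena, genb])
    (by ext i; fin_cases i <;> simp [gena, genb])

def autC : MulAut (FreeGroup (Fin 2)) :=
  MonoidHom.toMulEquiv (FreeGroup.lift ![genb, (gena * genb)⁻¹])
    (FreeGroup.lift ![(gena * genb)⁻¹, gena])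
    (by ext i; fin_cases i <;> simp [gena, genb])
    (by ext i; fin_cases i <;> simp [gena, genb])

lemma XX_T (A₁ A₂ : SL2C) (α : MulAut (FreeGroup (Fin 2))) :
    XX A₁ A₂ (α * autT) = tT (XX A₁ A₂ α) := by
  rw [XX, XX, ← tr3_T]
  simp [autT, MulAut.mul_apply, gena, genb]

lemma XX_C (A₁ A₂ : SL2C) (α : MulAut (FreeGroup (Fin 2))) :
    XX A₁ A₂ (α * autC) = tC (XX A₁ A₂ α) := by
  rw [XX, XX, ← tr3_C]
  simp [autC, MulAut.mul_apply, gena, genb]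

lemma XX_act (A₁ A₂ : SL2C) (w : List Bool) : ∃ β : MulAut (FreeGroup (Fin 2)), ∀ α,
    XX A₁ A₂ (α * β) = act w (XX A₁ A₂ α) := by
  induction w with
  | nil => exact ⟨1, fun α => by simp [act]⟩
  | cons m w ih =>
    obtain ⟨β, hβ⟩ := ih
    cases m
    · exact ⟨β * autC, fun α => by rw [← mul_assoc, XX_C, hβ, act]⟩
    · exact ⟨β * autT, fun α => by rw [← mul_assoc, XX_T, hβ, act]⟩

lemma XX_iter (A₁ A₂ : SL2C) (α : MulAut (FreeGroup (Fin 2))) (k : ℕ) :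
    XX A₁ A₂ (α * autT ^ k) = tT^[k] (XX A₁ A₂ α) := by
  induction k with
  | zero => simp
  | succ k ih => rw [pow_succ, ← mul_assoc, XX_T, ih, Function.iterate_succ_apply']

lemma XX_one (A₁ A₂ : SL2C) : XX A₁ A₂ 1 = tr3 A₁ A₂ := by
  simp [XX, rho]

lemma XX_chi (A₁ A₂ : SL2C) (α : MulAut (FreeGroup (Fin 2))) :
    XX A₁ A₂ α = ((chi A₁ A₂ α).1 * 2, (chi A₁ A₂ α).2.1 * 2, (chi A₁ A₂ α).2.2 * 2) := by
  simp [XX, chi, tr3]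

lemma perT_of_elem (A₁ A₂ : SL2C) (h : ElemPeriodic A₁ A₂) : PerT (tr3 A₁ A₂) := by
  intro w
  obtain ⟨β, hβ⟩ := XX_act A₁ A₂ w
  have hfin : (Set.range fun k : ℕ => XX A₁ A₂ ((β * autT * β⁻¹) ^ k)).Finite := by
    have := (h (β * autT * β⁻¹)).image (fun q : ℂ × ℂ × ℂ => (q.1 * 2, q.2.1 * 2, q.2.2 * 2))
    refine this.subset ?_
    rintro _ ⟨k, rfl⟩
    exact ⟨_, ⟨k, rfl⟩, (XX_chi _ _ _).symm⟩
  have e : ∀ k, tT^[k] (act w (tr3 A₁ A₂)) = act w (XX A₁ A₂ ((β * autT * β⁻¹) ^ k)) := by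
    intro k
    rw [← hβ, conj_pow, ← XX_one, ← hβ, ← XX_iter]
    congr 1
    group
  obtain ⟨m, n, hmn, he⟩ := (hfin.image (act w)).exists_lt_map_eq_of_forall_mem
    (f := fun k : ℕ => tT^[k] (act w (tr3 A₁ A₂)))
    (fun k => by
      rw [e k]
      exact Set.mem_image_of_mem _ ⟨k, rfl⟩)
  refine ⟨n - m, by omega, ?_⟩
  apply tT_inj.iterate m
  rw [← Function.iterate_add_apply, Nat.add_sub_cancel' hmn.le]
  exact he.symm

/-! ### Reducible case -/

/-- Eigenvector form: `w` is a left eigenvector iff this vanishes. -/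
def fE (M : Matrix (Fin 2) (Fin 2) ℂ) (x y : ℂ) : ℂ :=
  x * y * (M 0 0 - M 1 1) + y ^ 2 * M 1 0 - x ^ 2 * M 0 1

lemma exists_root (M : Matrix (Fin 2) (Fin 2) ℂ) : ∃ x y : ℂ, (x ≠ 0 ∨ y ≠ 0) ∧ fE M x y = 0 := by
  by_cases h : M 1 0 = 0
  · exact ⟨0, 1, by simp, by simp [fE, h]⟩
  · obtain ⟨s, hs⟩ := IsAlgClosed.exists_pow_nat_eq
      ((M 0 0 - M 1 1) ^ 2 + 4 * M 1 0 * M 0 1) (n := 2) (by norm_num)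
    refine ⟨1, (-(M 0 0 - M 1 1) + s) / (2 * M 1 0), by simp, ?_⟩
    simp only [fE]
    field_simp
    linear_combination hs

lemma common_root (A B : Matrix (Fin 2) (Fin 2) ℂ) (h : (A * B - B * A).det = 0) :
    ∃ x y : ℂ, (x ≠ 0 ∨ y ≠ 0) ∧ fE A x y = 0 ∧ fE B x y = 0 := by
  set a := A 0 0 - A 1 1 with ha
  set b := B 0 0 - B 1 1 with hb
  set X := A 0 1 * B 1 0 - B 0 1 * A 1 0 with hX
  set Y := a * B 0 1 - b * A 0 1 with hY
  set Z := A 1 0 * b - B 1 0 * a with hZ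
  have hdet : X ^ 2 + Y * Z = 0 := by
    rw [Matrix.det_fin_two] at h
    simp only [Matrix.sub_apply, Matrix.mul_apply, Fin.sum_univ_two] at h
    simp only [hX, hY, hZ, ha, hb]
    linear_combination -h
  have tA : X * a + Y * A 1 0 + Z * A 0 1 = 0 := by simp only [hX, hY, hZ]; ring
  have tB : X * b + Y * B 1 0 + Z * B 0 1 = 0 := by simp only [hX, hY, hZ]; ring
  by_cases h1 : X ≠ 0 ∨ Y ≠ 0
  · refine ⟨X, Y, h1, ?_, ?_⟩
    · simp only [fE, ← ha]
      linear_combination Y * tA - A 0 1 * hdet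
    · simp only [fE, ← hb]
      linear_combination Y * tB - B 0 1 * hdet
  push Not at h1
  obtain ⟨hX0, hY0⟩ := h1
  by_cases h2 : Z ≠ 0
  · rw [hX0, hY0] at tA tB
    refine ⟨1, 0, by simp, ?_, ?_⟩
    · simp only [fE]
      have : A 0 1 = 0 := by simpa [h2] using tA
      simp [this]
    · simp only [fE]
      have : B 0 1 = 0 := by simpa [h2] using tB
      simp [this]
  push Not at h2
  obtain ⟨x, y, hxy, he⟩ := exists_root A
  simp only [fE, ← ha] at he
  -- if some entry of the traceless data of `A` is nonzero, `B` is proportional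
  by_cases hA : a = 0 ∧ A 0 1 = 0 ∧ A 1 0 = 0
  · obtain ⟨x, y, hxy, he⟩ := exists_root B
    refine ⟨x, y, hxy, ?_, he⟩
    simp [fE, ← ha, hA.1, hA.2.1, hA.2.2]
  refine ⟨x, y, hxy, he, ?_⟩
  simp only [fE, ← hb]
  have k1 : a * (x * y * b + y ^ 2 * B 1 0 - x ^ 2 * B 0 1) = 0 := by
    linear_combination b * he - y ^ 2 * h2 - x ^ 2 * hY0 + y^2 * hZ + x^2 * hY
  have k2 : A 0 1 * (x * y * b + y ^ 2 * B 1 0 - x ^ 2 * B 0 1) = 0 := by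
    linear_combination B 0 1 * he - x * y * hY0 + y ^ 2 * hX0 - y ^ 2 * hX + x * y * hY
  have k3 : A 1 0 * (x * y * b + y ^ 2 * B 1 0 - x ^ 2 * B 0 1) = 0 := by
    linear_combination B 1 0 * he + x * y * h2 + x ^ 2 * hX0 - x ^ 2 * hX - x * y * hZ
  by_contra hne
  exact hA ⟨(mul_eq_zero.1 k1).resolve_right hne, (mul_eq_zero.1 k2).resolve_right hne,
    (mul_eq_zero.1 k3).resolve_right hne⟩

lemma eig_of_fE (M : Matrix (Fin 2) (Fin 2) ℂ) (x y : ℂ) (hxy : x ≠ 0 ∨ y ≠ 0)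
    (h : fE M x y = 0) : ∃ l, x * M 0 0 + y * M 1 0 = l * x ∧ x * M 0 1 + y * M 1 1 = l * y := by
  simp only [fE] at h
  by_cases hx : x = 0
  · subst hx
    have hy : y ≠ 0 := by simpa using hxy
    have : M 1 0 = 0 := by simpa [hy] using h
    exact ⟨M 1 1, by simp [this], by ring⟩
  · refine ⟨(x * M 0 0 + y * M 1 0) / x, by field_simp, ?_⟩
    field_simp
    linear_combination -h

lemma conj_lower (P : GL (Fin 2) ℂ) (A : SL2C) (l : ℂ)
    (h0 : P.1 0 0 * A.1 0 0 + P.1 0 1 * A.1 1 0 = l * P.1 0 0)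
    (h1 : P.1 0 0 * A.1 0 1 + P.1 0 1 * A.1 1 1 = l * P.1 0 1) :
    let B := (P : Matrix (Fin 2) (Fin 2) ℂ) * (A : Matrix (Fin 2) (Fin 2) ℂ) *
        ((P⁻¹ : GL (Fin 2) ℂ) : Matrix (Fin 2) (Fin 2) ℂ)
    B 0 1 = 0 ∧ B 0 0 ^ 2 - A.1.trace * B 0 0 + 1 = 0 ∧
      B 1 1 ^ 2 - A.1.trace * B 1 1 + 1 = 0 := by
  intro B
  have hPP : (P : Matrix (Fin 2) (Fin 2) ℂ) * ((P⁻¹ : GL (Fin 2) ℂ) : Matrix (Fin 2) (Fin 2) ℂ) = 1 :=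
    P.mul_inv
  have hPP' : ((P⁻¹ : GL (Fin 2) ℂ) : Matrix (Fin 2) (Fin 2) ℂ) * (P : Matrix (Fin 2) (Fin 2) ℂ) = 1 :=
    P.inv_mul
  have row : ∀ j, B 0 j = l * (1 : Matrix (Fin 2) (Fin 2) ℂ) 0 j := by
    intro j
    rw [← hPP]
    simp only [B, Matrix.mul_apply, Fin.sum_univ_two]
    linear_combination ((P⁻¹ : GL (Fin 2) ℂ) : Matrix (Fin 2) (Fin 2) ℂ) 0 j * h0 +
      ((P⁻¹ : GL (Fin 2) ℂ) : Matrix (Fin 2) (Fin 2) ℂ) 1 j * h1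
  have b0 : B 0 0 = l := by simpa using row 0
  have b1 : B 0 1 = 0 := by simpa using row 1
  have htr : B.trace = A.1.trace := by
    simp only [B]
    rw [Matrix.trace_mul_comm, ← mul_assoc, hPP', one_mul]
  have hdet : B.det = 1 := by
    simp only [B]
    rw [Matrix.det_mul, Matrix.det_mul, mul_right_comm, ← Matrix.det_mul, hPP, A.2]
    simp
  rw [Matrix.det_fin_two, b1] at hdet
  rw [← htr, Matrix.trace_fin_two]
  refine ⟨b1, ?_, ?_⟩ <;> linear_combination -hdet

lemma exists_P (x y : ℂ) (hxy : x ≠ 0 ∨ y ≠ 0) : ∃ P : GL (Fin 2) ℂ, P.1 0 0 = x ∧ P.1 0 1 = y := by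
  by_cases hx : x = 0
  · have hy : y ≠ 0 := by simpa [hx] using hxy
    exact ⟨Matrix.GeneralLinearGroup.mkOfDetNeZero !![x, y; 1, 0] (by simpa [Matrix.det_fin_two]),
      rfl, rfl⟩
  · exact ⟨Matrix.GeneralLinearGroup.mkOfDetNeZero !![x, y; 0, 1] (by simpa [Matrix.det_fin_two]),
      rfl, rfl⟩

lemma comm_det (A B : SL2C) : (A.1 * B.1 - B.1 * A.1).det = DD (tr3 A B) := by
  have hA := det_eq A
  have hB := det_eq B
  rw [Matrix.det_fin_two]
  simp only [DD, tr3, Matrix.SpecialLinearGroup.coe_mul,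
    Matrix.trace_fin_two, Matrix.sub_apply, Matrix.mul_apply, Fin.sum_univ_two]
  linear_combination
    (4 * (B.1 0 0 * B.1 1 1 - B.1 0 1 * B.1 1 0) - (B.1 0 0 + B.1 1 1) ^ 2) * hA
      + (4 - (A.1 0 0 + A.1 1 1) ^ 2) * hB

lemma reducible_case (A B : SL2C) (h : PerT (tr3 A B)) (ho : OffAxis (tr3 A B))
    (hD : DD (tr3 A B) = 0) :
    (∃ P : GL (Fin 2) ℂ,
      let B₁ := (P : Matrix (Fin 2) (Fin 2) ℂ) * (A : Matrix (Fin 2) (Fin 2) ℂ) *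
        ((P⁻¹ : GL (Fin 2) ℂ) : Matrix (Fin 2) (Fin 2) ℂ);
      let B₂ := (P : Matrix (Fin 2) (Fin 2) ℂ) * (B : Matrix (Fin 2) (Fin 2) ℂ) *
        ((P⁻¹ : GL (Fin 2) ℂ) : Matrix (Fin 2) (Fin 2) ℂ);
      B₁ 0 1 = 0 ∧ B₂ 0 1 = 0 ∧
      (∃ m : ℕ, 0 < m ∧ (B₁ 0 0) ^ m = 1) ∧ (∃ m : ℕ, 0 < m ∧ (B₁ 1 1) ^ m = 1) ∧
      (∃ m : ℕ, 0 < m ∧ (B₂ 0 0) ^ m = 1) ∧ (∃ m : ℕ, 0 < m ∧ (B₂ 1 1) ^ m = 1)) := by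
  rw [← comm_det] at hD
  obtain ⟨x, y, hxy, fA, fB⟩ := common_root _ _ hD
  obtain ⟨l, l0, l1⟩ := eig_of_fE _ x y hxy fA
  obtain ⟨m, m0, m1⟩ := eig_of_fE _ x y hxy fB
  obtain ⟨P, rfl, rfl⟩ := exists_P x y hxy
  obtain ⟨a0, a1, a2⟩ := conj_lower P A l l0 l1
  obtain ⟨b0, b1, b2⟩ := conj_lower P B m m0 m1
  obtain ⟨N, hN, eN⟩ := h []
  obtain ⟨M, hM, eM⟩ := h [false]
  have rA := root_lem _ ho N eN
  have rB := root_lem _ (ho.act [false]) M eM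
  exact ⟨P, a0, b0, ⟨2 * N, by omega, rA _ a1⟩, ⟨2 * N, by omega, rA _ a2⟩,
    ⟨2 * M, by omega, rB _ b1⟩, ⟨2 * M, by omega, rB _ b2⟩⟩

/-! ### Irreducible case -/

/-- The norm form of the quaternion order spanned by `1, A, B, AB`. -/
def NN {R : Type*} [CommRing R] (t : R × R × R) (p q r s : R) : R :=
  p ^ 2 + q ^ 2 + r ^ 2 + s ^ 2 + t.1 * (p * q + r * s) + t.2.1 * (p * r + q * s)
    + t.2.2 * (p * s) + (t.1 * t.2.1 - t.2.2) * (q * r)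

lemma NN_map {R S : Type*} [CommRing R] [CommRing S] (f : R →+* S) (t : R × R × R) (p q r s : R) :
    NN (mp f t) (f p) (f q) (f r) (f s) = f (NN t p q r s) := by
  simp [NN, mp]

lemma form_bound1 (t : ℝ × ℝ × ℝ) (ha : |t.1| ≤ 2) (hD : 0 < DD t) (p q r s : ℝ)
    (hN : NN t p q r s = 1) : s ^ 2 ≤ 4 / DD t := by
  obtain ⟨a, b, c⟩ := t
  rw [le_div_iff₀ hD]
  simp only [NN] at hN
  simp only [DD] at hD ⊢
  simp only at ha
  have ha4 : 0 < 1 - a ^ 2 / 4 := by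
    have h1 : a ^ 2 ≤ 2 ^ 2 := sq_le_sq.2 (ha.trans (le_abs_self 2))
    rcases h1.eq_or_lt with h | h
    · exfalso
      have : (a - 2) * (a + 2) = 0 := by linear_combination h
      rcases mul_eq_zero.1 this with h | h
      · have : a = 2 := by linarith
        subst this
        nlinarith [sq_nonneg (b - c)]
      · have : a = -2 := by linarith
        subst this
        nlinarith [sq_nonneg (b + c)]
    · linarith
  have key : (1 - a ^ 2 / 4) * (1 - s ^ 2 * ((4 - a ^ 2 - b ^ 2 - c ^ 2 + a * b * c) / 4)) =
      (1 - a ^ 2 / 4) * (p + a * q / 2 + b * r / 2 + c * s / 2) ^ 2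
      + ((1 - a ^ 2 / 4) * q + (a * b / 2 - c) / 2 * r + (b - a * c / 2) / 2 * s) ^ 2
      + ((4 - a ^ 2 - b ^ 2 - c ^ 2 + a * b * c) / 4) * (r + a / 2 * s) ^ 2 := by
    linear_combination -(1 - a ^ 2 / 4) * hN
  have h2 : 0 ≤ (1 - a ^ 2 / 4) * (1 - s ^ 2 * ((4 - a ^ 2 - b ^ 2 - c ^ 2 + a * b * c) / 4)) := by
    rw [key]; positivity
  have := nonneg_of_mul_nonneg_right h2 ha4
  linarith

lemma form_bound (t : ℝ × ℝ × ℝ) (ha : |t.1| ≤ 2) (hD : 0 < DD t) (p q r s : ℝ)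
    (hN : NN t p q r s = 1) :
    p ^ 2 ≤ 4 / DD t ∧ q ^ 2 ≤ 4 / DD t ∧ r ^ 2 ≤ 4 / DD t ∧ s ^ 2 ≤ 4 / DD t := by
  have e : DD (t.1, t.2.1, t.1 * t.2.1 - t.2.2) = DD t := by simp only [DD]; ring
  refine ⟨?_, ?_, ?_, form_bound1 t ha hD p q r s hN⟩
  · exact form_bound1 t ha hD s r q p (by rw [← hN]; simp only [NN]; ring)
  · rw [← e] at hD ⊢
    exact form_bound1 (t.1, t.2.1, t.1 * t.2.1 - t.2.2) ha hD r s p q (by rw [← hN]; simp only [NN]; ring)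
  · rw [← e] at hD ⊢
    exact form_bound1 (t.1, t.2.1, t.1 * t.2.1 - t.2.2) ha hD q p s r (by rw [← hN]; simp only [NN]; ring)

def comb (A B : SL2C) (p q r s : ℂ) : Matrix (Fin 2) (Fin 2) ℂ :=
  p • (1 : Matrix (Fin 2) (Fin 2) ℂ) + q • A.1 + r • B.1 + s • (A.1 * B.1)

lemma comb_det (A B : SL2C) (p q r s : ℂ) : (comb A B p q r s).det = NN (tr3 A B) p q r s := by
  have hA := det_eq A
  have hB := det_eq B
  rw [Matrix.det_fin_two]
  simp only [comb, NN, tr3, Matrix.SpecialLinearGroup.coe_mul, Matrix.trace_fin_two,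
    Matrix.add_apply, Matrix.smul_apply, Matrix.mul_apply, Fin.sum_univ_two, smul_eq_mul,
    Matrix.one_apply_eq, Matrix.one_apply_ne (zero_ne_one : (0 : Fin 2) ≠ 1),
    Matrix.one_apply_ne (one_ne_zero : (1 : Fin 2) ≠ 0)]
  linear_combination (q ^ 2 + (B.1 0 0 + B.1 1 1) * q * s
    + s ^ 2 * (B.1 0 0 * B.1 1 1 - B.1 0 1 * B.1 1 0)) * hA
    + (r ^ 2 + (A.1 0 0 + A.1 1 1) * r * s + s ^ 2) * hB

lemma sq_eq (A : SL2C) : A.1 * A.1 = A.1.trace • A.1 - 1 := by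
  have hA := det_eq A
  ext i j
  fin_cases i <;> fin_cases j <;>
    simp [Matrix.mul_apply, Fin.sum_univ_two, Matrix.trace_fin_two]
  · linear_combination -hA
  · ring
  · ring
  · linear_combination -hA

lemma fricke (A B : Matrix (Fin 2) (Fin 2) ℂ) : B * A = -(A * B) + A.trace • B + B.trace • A
    + ((A * B).trace - A.trace * B.trace) • (1 : Matrix (Fin 2) (Fin 2) ℂ) := by
  ext i j
  fin_cases i <;> fin_cases j <;>
    simp [Matrix.mul_apply, Fin.sum_univ_two, Matrix.trace_fin_two] <;> ring

lemma bab (A B : SL2C) : B.1 * (A.1 * B.1) = A.1 - A.1.trace • (1 : Matrix (Fin 2) (Fin 2) ℂ)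
    + (A.1 * B.1).trace • B.1 := by
  rw [← mul_assoc, fricke A.1 B.1]
  simp only [add_mul, neg_mul, smul_mul_assoc, one_mul, mul_assoc, sq_eq B, mul_sub,
    mul_smul_comm, mul_one]
  module

lemma A_comb (A B : SL2C) (p q r s : ℂ) :
    A.1 * comb A B p q r s = comb A B (-q) (p + A.1.trace * q) (-s) (r + A.1.trace * s) := by
  simp only [comb, mul_add, mul_smul_comm, mul_one, sq_eq A, ← mul_assoc, sub_mul, smul_mul_assoc,
    one_mul]
  module

lemma B_comb (A B : SL2C) (p q r s : ℂ) :
    B.1 * comb A B p q r s =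
      comb A B (q * ((A.1 * B.1).trace - A.1.trace * B.1.trace) - r - A.1.trace * s)
        (B.1.trace * q + s) (p + A.1.trace * q + B.1.trace * r + (A.1 * B.1).trace * s) (-q) := by
  simp only [comb, mul_add, mul_smul_comm, mul_one, sq_eq B, bab, fricke A.1 B.1]
  module

lemma inv_val (A : SL2C) : (A⁻¹ : SL2C).1 = A.1.trace • (1 : Matrix (Fin 2) (Fin 2) ℂ) - A.1 := by
  rw [Matrix.SpecialLinearGroup.coe_inv, Matrix.adjugate_fin_two]
  ext i j
  fin_cases i <;> fin_cases j <;> simp [Matrix.trace_fin_two]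

lemma comb_smul_sub (A B : SL2C) (t p q r s p' q' r' s' : ℂ) :
    t • comb A B p q r s - comb A B p' q' r' s' =
      comb A B (t * p - p') (t * q - q') (t * r - r') (t * s - s') := by
  simp only [comb]
  module

lemma closure_rep (A B : SL2C) (S : Subring ℂ) (ha : A.1.trace ∈ S) (hb : B.1.trace ∈ S)
    (hc : (A.1 * B.1).trace ∈ S) (g : SL2C) (hg : g ∈ Subgroup.closure {A, B}) :
    ∃ p ∈ S, ∃ q ∈ S, ∃ r ∈ S, ∃ s ∈ S, g.1 = comb A B p q r s := by
  induction hg using Subgroup.closure_induction_left with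
  | one => exact ⟨1, S.one_mem, 0, S.zero_mem, 0, S.zero_mem, 0, S.zero_mem, by simp [comb]⟩
  | mul_left x hx y hy ih =>
    obtain ⟨p, hp, q, hq, r, hr, s, hs, e⟩ := ih
    rcases hx with rfl | hx
    · refine ⟨_, ?_, _, ?_, _, ?_, _, ?_, by
        rw [Matrix.SpecialLinearGroup.coe_mul, e, A_comb]⟩ <;> aesop
    · obtain rfl : x = B := hx
      refine ⟨_, ?_, _, ?_, _, ?_, _, ?_, by
        rw [Matrix.SpecialLinearGroup.coe_mul, e, B_comb]⟩ <;>
      (repeat first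
        | assumption
        | with_reducible apply S.add_mem
        | with_reducible apply S.sub_mem
        | with_reducible apply S.mul_mem
        | with_reducible apply S.neg_mem)
  | inv_mul_cancel x hx y hy ih =>
    obtain ⟨p, hp, q, hq, r, hr, s, hs, e⟩ := ih
    rcases hx with rfl | hx
    · refine ⟨_, ?_, _, ?_, _, ?_, _, ?_, by
        rw [Matrix.SpecialLinearGroup.coe_mul, inv_val, e, sub_mul, smul_mul_assoc, one_mul, A_comb,
          comb_smul_sub]⟩ <;>
      (repeat first
        | assumption
        | with_reducible apply S.add_mem
        | with_reducible apply S.sub_mem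
        | with_reducible apply S.mul_mem
        | with_reducible apply S.neg_mem)
    · obtain rfl : x = B := hx
      refine ⟨_, ?_, _, ?_, _, ?_, _, ?_, by
        rw [Matrix.SpecialLinearGroup.coe_mul, inv_val, e, sub_mul, smul_mul_assoc, one_mul, B_comb,
          comb_smul_sub]⟩ <;>
      (repeat first
        | assumption
        | with_reducible apply S.add_mem
        | with_reducible apply S.sub_mem
        | with_reducible apply S.mul_mem
        | with_reducible apply S.neg_mem)

def goodRing (K : Type*) [Field K] : Subring K :=
  (integralClosure ℤ K).toSubring ⊓ ⨅ φ : K →+* ℂ, (Complex.ofRealHom.range).comap φ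

lemma mem_goodRing {K : Type*} [Field K] (x : K) : x ∈ goodRing K ↔
    IsIntegral ℤ x ∧ ∀ φ : K →+* ℂ, ∃ r : ℝ, (r : ℂ) = φ x := by
  simp [goodRing, Subring.mem_inf, Subring.mem_iInf, mem_integralClosure_iff]

lemma finite_core (K : Type*) [Field K] [NumberField K] (f : K →+* ℂ) (t : K × K × K)
    (A B : SL2C) (hf : mp f t = tr3 A B) (h : PerT t) (ho : OffAxis t) (hD : DD t ≠ 0) :
    ((Subgroup.closure {A, B} : Subgroup SL2C) : Set SL2C).Finite := by
  have hφ : ∀ φ : K →+* ℂ, ∃ r : ℝ × ℝ × ℝ, mp φ t = mp Complex.ofRealHom r ∧ 0 < DD r ∧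
      |r.1| ≤ 2 := by
    intro φ
    obtain ⟨r, hr, h0, hb⟩ := complex_main (mp φ t) (ho.map φ φ.injective) (h.map φ)
    refine ⟨r, hr, lt_of_le_of_ne h0 ?_, hb⟩
    intro h0
    have := DD_map φ t
    rw [hr, DD_map, ← h0, map_zero] at this
    exact hD ((map_eq_zero φ).1 this.symm)
  choose r hr hpos hb using hφ
  obtain ⟨M, hM⟩ := (Set.finite_range fun φ => 4 / DD (r φ)).bddAbove
  have hM' : ∀ φ, 4 / DD (r φ) ≤ M := fun φ => hM ⟨φ, rfl⟩
  have hgood : ∀ w, (act w t).1 ∈ goodRing K := by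
    intro w
    rw [mem_goodRing]
    constructor
    · have := (fst_props (mp f (act w t)) ((ho.act w).map f f.injective) ((h.act w).map f)).1
      exact (isIntegral_algHom_iff f.toIntAlgHom f.injective).1 this
    · intro φ
      obtain ⟨-, s, hs, -⟩ :=
        fst_props (mp φ (act w t)) ((ho.act w).map φ φ.injective) ((h.act w).map φ)
      exact ⟨s, hs.symm⟩
  have g1 : t.1 ∈ goodRing K := hgood []
  have g2 : t.2.1 ∈ goodRing K := hgood [false]
  have g3 : t.2.2 ∈ goodRing K := hgood [false, false]
  have hfin := NumberField.Embeddings.finite_of_norm_le K ℂ (Real.sqrt M)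
  set F := {x : K | IsIntegral ℤ x ∧ ∀ φ : K →+* ℂ, ‖φ x‖ ≤ Real.sqrt M} with hF
  have hfin4 := (hfin.prod (hfin.prod (hfin.prod hfin))).image
    (fun z : K × K × K × K => comb A B (f z.1) (f z.2.1) (f z.2.2.1) (f z.2.2.2))
  refine Set.Finite.of_finite_image (f := fun g : SL2C => g.1) (hfin4.subset ?_)
    (Subtype.val_injective.injOn)
  rintro _ ⟨g, hg, rfl⟩
  have e1 : f t.1 = A.1.trace := congrArg Prod.fst hf
  have e2 : f t.2.1 = B.1.trace := congrArg (fun z => z.2.1) hf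
  have e3 : f t.2.2 = (A.1 * B.1).trace := congrArg (fun z => z.2.2) hf
  obtain ⟨_, ⟨p, hp, rfl⟩, _, ⟨q, hq, rfl⟩, _, ⟨u, hu, rfl⟩, _, ⟨s, hs, rfl⟩, e⟩ :=
    closure_rep A B ((goodRing K).map f) ⟨_, g1, e1⟩ ⟨_, g2, e2⟩ ⟨_, g3, e3⟩ g hg
  have hN : NN t p q u s = 1 := by
    have h1 := comb_det A B (f p) (f q) (f u) (f s)
    rw [← e, g.2, ← hf, NN_map] at h1
    exact f.injective (by rw [← h1, map_one])
  have bnd : ∀ φ : K →+* ℂ, ‖φ p‖ ≤ Real.sqrt M ∧ ‖φ q‖ ≤ Real.sqrt M ∧ ‖φ u‖ ≤ Real.sqrt M ∧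
      ‖φ s‖ ≤ Real.sqrt M := by
    intro φ
    obtain ⟨p', hp'⟩ := ((mem_goodRing p).1 hp).2 φ
    obtain ⟨q', hq'⟩ := ((mem_goodRing q).1 hq).2 φ
    obtain ⟨u', hu'⟩ := ((mem_goodRing u).1 hu).2 φ
    obtain ⟨s', hs'⟩ := ((mem_goodRing s).1 hs).2 φ
    have hN' : NN (r φ) p' q' u' s' = 1 := by
      have h1 := NN_map φ t p q u s
      rw [hN, map_one, ← hp', ← hq', ← hu', ← hs', hr φ] at h1
      have h2 := NN_map Complex.ofRealHom (r φ) p' q' u' s'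
      exact Complex.ofReal_injective (h2.symm.trans (h1.trans Complex.ofReal_one.symm))
    obtain ⟨b1, b2, b3, b4⟩ := form_bound (r φ) (hb φ) (hpos φ) _ _ _ _ hN'
    rw [← hp', ← hq', ← hu', ← hs']
    simp only [Complex.norm_real, Real.norm_eq_abs]
    exact ⟨Real.abs_le_sqrt (b1.trans (hM' φ)), Real.abs_le_sqrt (b2.trans (hM' φ)),
      Real.abs_le_sqrt (b3.trans (hM' φ)), Real.abs_le_sqrt (b4.trans (hM' φ))⟩
  refine ⟨(p, q, u, s), ⟨⟨((mem_goodRing p).1 hp).1, fun φ => (bnd φ).1⟩,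
    ⟨((mem_goodRing q).1 hq).1, fun φ => (bnd φ).2.1⟩,
    ⟨((mem_goodRing u).1 hu).1, fun φ => (bnd φ).2.2.1⟩,
    ⟨((mem_goodRing s).1 hs).1, fun φ => (bnd φ).2.2.2⟩⟩, e.symm⟩

lemma exists_field (p : ℂ × ℂ × ℂ) (i1 : IsIntegral ℤ p.1) (i2 : IsIntegral ℤ p.2.1)
    (i3 : IsIntegral ℤ p.2.2) : ∃ (K : Type) (_ : Field K) (_ : NumberField K) (f : K →+* ℂ)
      (t : K × K × K), mp f t = p := by
  let K := IntermediateField.adjoin ℚ ({p.1, p.2.1, p.2.2} : Set ℂ)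
  have hfd : FiniteDimensional ℚ K := by
    apply IntermediateField.finiteDimensional_adjoin
    rintro x (rfl | rfl | rfl)
    · exact i1.tower_top
    · exact i2.tower_top
    · exact i3.tower_top
  have hn : NumberField K := { to_charZero := inferInstance, to_finiteDimensional := hfd }
  exact ⟨K, inferInstance, hn, algebraMap K ℂ,
    (⟨p.1, IntermediateField.subset_adjoin _ _ (by simp)⟩,
    ⟨p.2.1, IntermediateField.subset_adjoin _ _ (by simp)⟩,
    ⟨p.2.2, IntermediateField.subset_adjoin _ _ (by simp)⟩), rfl⟩

lemma finite_case (A B : SL2C) (h : PerT (tr3 A B)) (ho : OffAxis (tr3 A B))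
    (hD : DD (tr3 A B) ≠ 0) :
    ((Subgroup.closure {A, B} : Subgroup SL2C) : Set SL2C).Finite := by
  obtain ⟨⟨i1, i2, i3⟩, -⟩ := coord_props _ ho h
  obtain ⟨K, _, _, f, t, ht⟩ := exists_field _ i1 i2 i3
  have inj : Function.Injective f := f.injective
  rw [← ht] at h ho hD
  refine finite_core K f t A B ht (h.of_map _ inj) (ho.of_map _ inj) ?_
  intro h0
  rw [DD_map, h0, map_zero] at hD
  exact hD rfl

lemma axis_logic (p q r : ℂ) (ho : ¬ OffAxis (p * 2, q * 2, r * 2)) :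
    (p = 0 ∧ q = 0) ∨ (p = 0 ∧ r = 0) ∨ (q = 0 ∧ r = 0) := by
  simp only [OffAxis, mul_eq_zero, OfNat.ofNat_ne_zero, or_false] at ho
  tauto

theorem stmt0 (A₁ A₂ : SL2C)
    (htr1 : (Matrix.trace ((A₁ : Matrix (Fin 2) (Fin 2) ℂ))).im = 0)
    (htr2 : (Matrix.trace ((A₂ : Matrix (Fin 2) (Fin 2) ℂ))).im = 0)
    (htr12 : (Matrix.trace (((A₁ * A₂ : SL2C) : Matrix (Fin 2) (Fin 2) ℂ))).im = 0)
    (hper : ElemPeriodic A₁ A₂) :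
    -- (1) the group generated by A₁, A₂ is finite
    ((Subgroup.closure {A₁, A₂} : Subgroup SL2C) : Set SL2C).Finite
    ∨
    -- (2) χ(id) lies on a coordinate axis of ℝ³
    ((chi A₁ A₂ 1).1 = 0 ∧ (chi A₁ A₂ 1).2.1 = 0) ∨
    ((chi A₁ A₂ 1).1 = 0 ∧ (chi A₁ A₂ 1).2.2 = 0) ∨
    ((chi A₁ A₂ 1).2.1 = 0 ∧ (chi A₁ A₂ 1).2.2 = 0)
    ∨
    -- (3) simultaneous lower-triangularization with diagonal entries roots of unity
    (∃ P : GL (Fin 2) ℂ,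
      let B₁ := (P : Matrix (Fin 2) (Fin 2) ℂ) * (A₁ : Matrix (Fin 2) (Fin 2) ℂ) *
        ((P⁻¹ : GL (Fin 2) ℂ) : Matrix (Fin 2) (Fin 2) ℂ);
      let B₂ := (P : Matrix (Fin 2) (Fin 2) ℂ) * (A₂ : Matrix (Fin 2) (Fin 2) ℂ) *
        ((P⁻¹ : GL (Fin 2) ℂ) : Matrix (Fin 2) (Fin 2) ℂ);
      B₁ 0 1 = 0 ∧ B₂ 0 1 = 0 ∧
      (∃ m : ℕ, 0 < m ∧ (B₁ 0 0) ^ m = 1) ∧ (∃ m : ℕ, 0 < m ∧ (B₁ 1 1) ^ m = 1) ∧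
      (∃ m : ℕ, 0 < m ∧ (B₂ 0 0) ^ m = 1) ∧ (∃ m : ℕ, 0 < m ∧ (B₂ 1 1) ^ m = 1)) := by
  by_cases ho : OffAxis (tr3 A₁ A₂)
  · have h := perT_of_elem A₁ A₂ hper
    by_cases hD : DD (tr3 A₁ A₂) = 0
    · exact Or.inr (Or.inr (Or.inr (Or.inr (reducible_case A₁ A₂ h ho hD))))
    · exact Or.inl (finite_case A₁ A₂ h ho hD)
  · have e := XX_chi A₁ A₂ 1
    rw [XX_one] at e
    rw [e] at ho
    rcases axis_logic _ _ _ ho with h | h | h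
    · exact Or.inr (Or.inl h)
    · exact Or.inr (Or.inr (Or.inl h))
    · exact Or.inr (Or.inr (Or.inr (Or.inl h)))

end
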